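/- Let A(u,v,w) = 4 + 2cos u + 2cos v + 2cos w + 2cos(u−v) + 2cos(u−w) + 2cos(v−w) and P(u,v,w,z) = z² − A(u,v,w). Then for every (u,v,w) ∈ ℝ³ with A(u,v,w) = 0, the point (u,v,w,0) is a critical point of P with critical value 0, and the 4×4 Hessian matrix of P at (u,v,w,0) is degenerate (its determinant is 0). In particular the diamond family has no Dirac points. -/

import Mathlib

open Real Matrix

/-- The function whose zero set is the degenerate locus of the diamond Harper Hamiltonian. -/
noncomputable def A (u v w : ℝ) : ℝ :=
  4 + 2 * Real.cos u + 2 * Real.cos v + 2 * Real.cos w +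
    2 * Real.cos (u - v) + 2 * Real.cos (u - w) + 2 * Real.cos (v - w)

/-- The characteristic polynomial of the diamond Harper Hamiltonian, as a
smooth real function of `(u, v, w, z)`. -/
noncomputable def P (u v w z : ℝ) : ℝ := z ^ 2 - A u v w

/-- Partial derivative in the first variable. -/
noncomputable def pdu (f : ℝ → ℝ → ℝ → ℝ → ℝ) (u v w z : ℝ) : ℝ :=
  deriv (fun t => f t v w z) u

/-- Partial derivative in the second variable. -/
noncomputable def pdv (f : ℝ → ℝ → ℝ → ℝ → ℝ) (u v w z : ℝ) : ℝ :=
  deriv (fun t => f u t w z) v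

/-- Partial derivative in the third variable. -/
noncomputable def pdw (f : ℝ → ℝ → ℝ → ℝ → ℝ) (u v w z : ℝ) : ℝ :=
  deriv (fun t => f u v t z) w

/-- Partial derivative in the fourth variable. -/
noncomputable def pdz (f : ℝ → ℝ → ℝ → ℝ → ℝ) (u v w z : ℝ) : ℝ :=
  deriv (fun t => f u v w t) z

/-- The Hessian matrix of `P` in the variables `(u, v, w, z)`, in this order. -/
noncomputable def hessP (u v w z : ℝ) : Matrix (Fin 4) (Fin 4) ℝ :=
  !![pdu (pdu P) u v w z, pdv (pdu P) u v w z, pdw (pdu P) u v w z, pdz (pdu P) u v w z;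
     pdu (pdv P) u v w z, pdv (pdv P) u v w z, pdw (pdv P) u v w z, pdz (pdv P) u v w z;
     pdu (pdw P) u v w z, pdv (pdw P) u v w z, pdw (pdw P) u v w z, pdz (pdw P) u v w z;
     pdu (pdz P) u v w z, pdv (pdz P) u v w z, pdw (pdz P) u v w z, pdz (pdz P) u v w z]

theorem A_eq_sq_add_sq (u v w : ℝ) :
    A u v w = (1 + cos u + cos v + cos w) ^ 2 + (sin u + sin v + sin w) ^ 2 := by
  simp only [A, cos_sub]
  linear_combination -sin_sq_add_cos_sq u - sin_sq_add_cos_sq v - sin_sq_add_cos_sq w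

theorem pdu_P : pdu P = fun u v w _ => 2 * sin u + 2 * sin (u - v) + 2 * sin (u - w) := by
  funext u v w z
  simp (disch := fun_prop) [pdu, P, A]
  ring

theorem pdv_P : pdv P = fun u v w _ => 2 * sin v - 2 * sin (u - v) + 2 * sin (v - w) := by
  funext u v w z
  simp (disch := fun_prop) [pdv, P, A]
  ring

theorem pdw_P : pdw P = fun u v w _ => 2 * sin w - 2 * sin (u - w) - 2 * sin (v - w) := by
  funext u v w z
  simp (disch := fun_prop) [pdw, P, A]
  ring

theorem pdz_P : pdz P = fun _ _ _ z => 2 * z := by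
  funext u v w z
  simp (disch := fun_prop) [pdz, P]

theorem hessP_eq (u v w z : ℝ) : hessP u v w z =
    !![2 * cos u + 2 * cos (u - v) + 2 * cos (u - w), -2 * cos (u - v), -2 * cos (u - w), 0;
       -2 * cos (u - v), 2 * cos v + 2 * cos (u - v) + 2 * cos (v - w), -2 * cos (v - w), 0;
       -2 * cos (u - w), -2 * cos (v - w), 2 * cos w + 2 * cos (u - w) + 2 * cos (v - w), 0;
       0, 0, 0, 2] := by
  rw [hessP, pdu_P, pdv_P, pdw_P, pdz_P]
  simp (disch := fun_prop) [pdu, pdv, pdw, pdz]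

/-- The Gram matrix of three unit vectors in the plane is singular. -/
theorem gram_cos_sub_det (u v w : ℝ) :
    1 + 2 * cos (u - v) * cos (u - w) * cos (v - w)
      - cos (u - v) ^ 2 - cos (u - w) ^ 2 - cos (v - w) ^ 2 = 0 := by
  have h : cos (u - w) = cos (u - v) * cos (v - w) - sin (u - v) * sin (v - w) := by
    rw [← cos_add]; ring_nf
  rw [h]
  linear_combination (-sin (v - w) ^ 2) * sin_sq_add_cos_sq (u - v)
    + (cos (u - v) ^ 2 - 1) * sin_sq_add_cos_sq (v - w)

theorem diamond_no_dirac_points (u v w : ℝ) (hA : A u v w = 0) :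
    P u v w 0 = 0 ∧
    pdu P u v w 0 = 0 ∧ pdv P u v w 0 = 0 ∧ pdw P u v w 0 = 0 ∧ pdz P u v w 0 = 0 ∧
    (hessP u v w 0).det = 0 := by
  have hsq := A_eq_sq_add_sq u v w
  rw [hA] at hsq
  have hc : 1 + cos u + cos v + cos w = 0 := by nlinarith
  have hs : sin u + sin v + sin w = 0 := by nlinarith
  refine ⟨by simp [P, hA], ?_, ?_, ?_, by simp [pdz_P], ?_⟩
  · simp only [pdu_P, sin_sub]
    linear_combination 2 * sin u * hc - 2 * cos u * hs
  · simp only [pdv_P, sin_sub]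
    linear_combination 2 * sin v * hc - 2 * cos v * hs
  · simp only [pdw_P, sin_sub]
    linear_combination 2 * sin w * hc - 2 * cos w * hs
  · have hu : 2 * cos u + 2 * cos (u - v) + 2 * cos (u - w) = -2 := by
      simp only [cos_sub]
      linear_combination 2 * cos u * hc + 2 * sin u * hs - 2 * sin_sq_add_cos_sq u
    have hv : 2 * cos v + 2 * cos (u - v) + 2 * cos (v - w) = -2 := by
      simp only [cos_sub]
      linear_combination 2 * cos v * hc + 2 * sin v * hs - 2 * sin_sq_add_cos_sq v
    have hw : 2 * cos w + 2 * cos (u - w) + 2 * cos (v - w) = -2 := by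
      simp only [cos_sub]
      linear_combination 2 * cos w * hc + 2 * sin w * hs - 2 * sin_sq_add_cos_sq w
    rw [hessP_eq, hu, hv, hw]
    simp [det_succ_row_zero, Fin.sum_univ_succ, Fin.succAbove]
    linear_combination (-16) * gram_cos_sub_det u v w
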